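/- (Reachability with exact transit time.) For every χ* ≥ 0 and every e* ≠ 0, set t* = σ e*² / (d (χ* + e*²)) and k = -e*/(d t*). Then 0 < t* ≤ σ/d, k ≠ 0, and the solution of the local event-clock system with constant input μⱼ(t) = k for all j and initial condition χ(0) = 0, e(0) = 0 satisfies χ(t*) = χ* and e(t*) = e*. In particular, every state (χ*, e*) with χ* ≥ 0 and e* ≠ 0 is reachable from the origin in time exactly σ e*² / (d (χ* + e*²)). -/

import Mathlib

open scoped BigOperators

/-- Two functions with the same derivative on `[0, ∞)` and the same value at `0` agree there. -/
theorem eq_of_hasDerivAt_eq_of_nonneg {f g f' : ℝ → ℝ}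
    (hf : ∀ t, 0 ≤ t → HasDerivAt f (f' t) t) (hg : ∀ t, 0 ≤ t → HasDerivAt g (f' t) t)
    (h0 : f 0 = g 0) {t : ℝ} (ht : 0 ≤ t) : f t = g t :=
  eq_of_has_deriv_right_eq (a := 0) (b := t)
    (fun x hx => (hf x hx.1).hasDerivWithinAt) (fun x hx => (hg x hx.1).hasDerivWithinAt)
    (fun x hx => (hf x hx.1).continuousAt.continuousWithinAt)
    (fun x hx => (hg x hx.1).continuousAt.continuousWithinAt)
    h0 t ⟨ht, le_rfl⟩

/-- The solution from the origin of the event-clock equations with constant coefficients. -/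
theorem eventClock_solution_of_const {A B : ℝ} {χ e : ℝ → ℝ}
    (hχ : ∀ t, 0 ≤ t → HasDerivAt χ (A + 2 * e t * B) t)
    (he : ∀ t, 0 ≤ t → HasDerivAt e (-B) t) (hχ0 : χ 0 = 0) (he0 : e 0 = 0)
    {t : ℝ} (ht : 0 ≤ t) : χ t = A * t - B ^ 2 * t ^ 2 ∧ e t = -B * t := by
  have hlin : ∀ s, 0 ≤ s → e s = -B * s := fun s hs =>
    eq_of_hasDerivAt_eq_of_nonneg (g := fun x => -B * x) he
      (fun x _ => by simpa using (hasDerivAt_id x).const_mul (-B)) (by simp [he0]) hs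
  refine ⟨?_, hlin t ht⟩
  refine eq_of_hasDerivAt_eq_of_nonneg (g := fun x => A * x - B ^ 2 * x ^ 2) hχ
    (fun x hx => ?_) (by simp [hχ0]) ht
  rw [hlin x hx]
  refine (((hasDerivAt_id x).const_mul A).sub
    ((hasDerivAt_pow 2 x).const_mul (B ^ 2))).congr_deriv ?_
  push_cast
  ring

/-- **reachability with exact transit time.**
For any `χ* ≥ 0` and `e* ≠ 0`, with `t* = σ e*² / (d (χ* + e*²))` and
`k = -e*/(d t*)` (where `d = ∑ⱼ wⱼ`), we have `0 < t* ≤ σ/d`, `k ≠ 0`, and any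
solution of the local event-clock system under the constant input `μⱼ(t) = k`
starting from `χ(0) = 0`, `e(0) = 0` reaches `(χ*, e*)` at time `t*`. -/
theorem reachability_exact_time
    (m : ℕ) (hm : 1 ≤ m) (σ : ℝ) (hσ : σ ∈ Set.Ioo (0 : ℝ) 1)
    (w : Fin m → ℝ) (hw : ∀ j, 0 < w j)
    (χstar estar : ℝ) (hχstar : 0 ≤ χstar) (hestar : estar ≠ 0)
    (d tstar k : ℝ)
    (hd : d = ∑ j, w j)
    (htstar : tstar = σ * estar ^ 2 / (d * (χstar + estar ^ 2)))
    (hk : k = -estar / (d * tstar)) :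
    0 < tstar ∧ tstar ≤ σ / d ∧ k ≠ 0 ∧
    ∀ χ e : ℝ → ℝ,
      (∀ t, 0 ≤ t → HasDerivAt χ
        (σ * (∑ j, w j * k ^ 2) + 2 * e t * (∑ j, w j * k)) t) →
      (∀ t, 0 ≤ t → HasDerivAt e (-(∑ j, w j * k)) t) →
      χ 0 = 0 → e 0 = 0 →
      χ tstar = χstar ∧ e tstar = estar := by
  obtain ⟨hσ0, -⟩ := hσ
  have hd0 : 0 < d := by
    rw [hd]
    exact Finset.sum_pos (fun j _ => hw j) ⟨⟨0, hm⟩, Finset.mem_univ _⟩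
  have he2 : 0 < estar ^ 2 := by positivity
  have hsum : 0 < χstar + estar ^ 2 := by positivity
  have ht0 : 0 < tstar := by rw [htstar]; positivity
  have hk0 : k ≠ 0 := by
    rw [hk]
    exact div_ne_zero (neg_ne_zero.mpr hestar) (mul_pos hd0 ht0).ne'
  refine ⟨ht0, ?_, hk0, fun χ e hχ he hχ0 he0 => ?_⟩
  · rw [htstar, div_le_div_iff₀ (by positivity) hd0]
    nlinarith [mul_nonneg (mul_pos hσ0 hd0).le hχstar]
  · simp only [← Finset.sum_mul, ← hd] at hχ he
    have hdt : d * k * tstar = -estar := by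
      rw [hk]
      field_simp
    have htr : d * tstar * (χstar + estar ^ 2) = σ * estar ^ 2 := by
      rw [htstar]
      field_simp
    obtain ⟨hχt, het⟩ := eventClock_solution_of_const hχ he hχ0 he0 ht0.le
    refine ⟨?_, by rw [het]; linear_combination -hdt⟩
    have hmul : d * tstar * (σ * (d * k ^ 2) * tstar) = d * tstar * (χstar + estar ^ 2) := by
      rw [htr]
      linear_combination σ * (d * k * tstar - estar) * hdt
    have hlead := mul_left_cancel₀ (mul_pos hd0 ht0).ne' hmul
    rw [hχt]
    linear_combination hlead - (d * k * tstar - estar) * hdt
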